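/- arXiv:1211.2582 — 3 statements merged into one kernel-verified Lean document; each statement's English description precedes it below -/
import Mathlib

section
/- For every probability measure μ on E_{n-1} with 0 < μ(π_{n/n-1}) < ∞, ω_n(μ) is a probability measure on E_n and it is invariant for the kernel K_{n,μ}: for every measurable set A ⊆ E_n, ∫ K_{n,μ}(x_n, A) ω_n(μ)(dx_n) = ω_n(μ)(A). -/
open MeasureTheory
open scoped ENNReal NNReal

namespace Paper

noncomputable section

/-- Total variation distance: `sup {|∫ f dμ - ∫ f dν| : f measurable, |f| ≤ 1}`. -/
def tvDist {Z : Type*} [MeasurableSpace Z] (μ ν : Measure Z) : ℝ :=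
  ⨆ f : { f : Z → ℝ // Measurable f ∧ ∀ z, |f z| ≤ 1 },
    |(∫ z, f.1 z ∂μ) - ∫ z, f.1 z ∂ν|

/-- `m`-step iterate of a kernel. -/
def iterK {Z : Type*} [MeasurableSpace Z] (K : Z → Measure Z) : ℕ → Z → Measure Z
  | 0 => fun z => Measure.dirac z
  | m + 1 => fun z => (iterK K m z).bind K

/-- Solution of the Poisson equation associated to `K` and `ω`. -/
def poissonSol {Z : Type*} [MeasurableSpace Z] (K : Z → Measure Z) (ω : Measure Z)
    (f : Z → ℝ) (z : Z) : ℝ :=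
  ∑' i : ℕ, ((∫ y, f y ∂(iterK K i z)) - ∫ y, f y ∂ω)

/-- `(δ_{z0} - ω') K'^i (K' - K) K^j (g)`, composed from left to right. -/
def crossTerm {Z : Type*} [MeasurableSpace Z] (K K' : Z → Measure Z) (ω' : Measure Z)
    (g : Z → ℝ) (z0 : Z) (i j : ℕ) : ℝ :=
  (∫ y, ((∫ a, (∫ b, g b ∂(iterK K j a)) ∂(K' y)) -
      ∫ a, (∫ b, g b ∂(iterK K j a)) ∂(K y)) ∂(iterK K' i z0)) -
    ∫ z, (∫ y, ((∫ a, (∫ b, g b ∂(iterK K j a)) ∂(K' y)) -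
      ∫ a, (∫ b, g b ∂(iterK K j a)) ∂(K y)) ∂(iterK K' i z)) ∂ω'

variable {X Y : Type*} [MeasurableSpace X] [MeasurableSpace Y]

/-- The importance weight `w_n`. -/
def weight (γm : X → ℝ≥0∞) (γn q : X × Y → ℝ≥0∞) (p : X × Y) : ℝ≥0∞ :=
  γn p / (γm p.1 * q p)

/-- The Metropolis–Hastings acceptance probability. -/
def accept (w : X × Y → ℝ≥0∞) (p p' : X × Y) : ℝ≥0∞ := min 1 (w p' / w p)

/-- The proposal distribution `μ × q_n`. -/
def proposal (dxY : Measure Y) (q : X × Y → ℝ≥0∞) (μ : Measure X) : Measure (X × Y) :=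
  (μ.prod dxY).withDensity q

/-- The Metropolis–Hastings kernel `K_{n,μ}`. -/
def mhK (dxY : Measure Y) (γm : X → ℝ≥0∞) (γn q : X × Y → ℝ≥0∞) (μ : Measure X)
    (p : X × Y) : Measure (X × Y) :=
  (proposal dxY q μ).withDensity (accept (weight γm γn q) p) +
    (1 - ∫⁻ p', accept (weight γm γn q) p p' ∂(proposal dxY q μ)) • Measure.dirac p

/-- The marginal density `π_n(x_{n-1})`. -/
def margN (dxY : Measure Y) (γn : X × Y → ℝ≥0∞) (Zn : ℝ≥0∞) (x : X) : ℝ≥0∞ :=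
  (∫⁻ y, γn (x, y) ∂dxY) / Zn

/-- The ratio `π_{n/n-1}(x_{n-1}) = π_n(x_{n-1}) / π_{n-1}(x_{n-1})`. -/
def ratioN (dxY : Measure Y) (γm : X → ℝ≥0∞) (γn : X × Y → ℝ≥0∞) (Zm Zn : ℝ≥0∞)
    (x : X) : ℝ≥0∞ :=
  margN dxY γn Zn x / (γm x / Zm)

/-- The conditional density `π̄_n(x_{n-1}, x)`. -/
def condN (dxY : Measure Y) (γn : X × Y → ℝ≥0∞) (Zn : ℝ≥0∞) (p : X × Y) : ℝ≥0∞ :=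
  (γn p / Zn) / margN dxY γn Zn p.1

/-- The invariant distribution `ω_n(μ)`. -/
def omegaN (dxY : Measure Y) (γm : X → ℝ≥0∞) (γn : X × Y → ℝ≥0∞) (Zm Zn : ℝ≥0∞)
    (μ : Measure X) : Measure (X × Y) :=
  (∫⁻ x, ratioN dxY γm γn Zm Zn x ∂μ)⁻¹ •
    (μ.prod dxY).withDensity fun p => ratioN dxY γm γn Zm Zn p.1 * condN dxY γn Zn p

theorem mul_accept {S T : Type*} {w : S × T → ℝ≥0∞} {p : S × T} (hw : w p ≠ ⊤) (p' : S × T) :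
    w p * accept w p p' = min (w p) (w p') := by
  unfold accept
  by_cases h0 : w p = 0
  · simp [h0]
  · rcases le_total (w p) (w p') with h | h
    · rw [min_eq_left ((ENNReal.le_div_iff_mul_le (Or.inl h0) (Or.inl hw)).2 (by simpa using h)),
        min_eq_left h, mul_one]
    · rw [min_eq_right (ENNReal.div_le_of_le_mul (by simpa using h)), min_eq_right h,
        ENNReal.mul_div_cancel h0 hw]

theorem measurable_accept {w : X × Y → ℝ≥0∞} (hw : Measurable w) :
    Measurable (Function.uncurry (accept w)) :=
  measurable_const.min ((hw.comp measurable_snd).div (hw.comp measurable_fst))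

/-- Metropolis–Hastings kernels with independent proposal `P` leave the measure with density `w`
with respect to `P` invariant. -/
theorem lintegral_accept_kernel (P : Measure (X × Y)) [IsProbabilityMeasure P]
    {w : X × Y → ℝ≥0∞} (hw : Measurable w) (hwt : ∀ p, w p ≠ ⊤)
    {A : Set (X × Y)} (hA : MeasurableSet A) :
    ∫⁻ p, (P.withDensity (accept w p) + (1 - ∫⁻ p', accept w p p' ∂P) • Measure.dirac p) A
      ∂(P.withDensity w) = P.withDensity w A := by
  have hacc := measurable_accept hw
  have hmin : Measurable (Function.uncurry fun p p' => min (w p) (w p')) :=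
    (hw.comp measurable_fst).min (hw.comp measurable_snd)
  have haccp (p : X × Y) : Measurable (accept w p) := hacc.of_uncurry_left
  have hint : Measurable fun p => ∫⁻ p', accept w p p' ∂P := hacc.lintegral_prod_right
  have hle (p : X × Y) : ∫⁻ p', accept w p p' ∂P ≤ 1 :=
    (lintegral_mono fun p' => min_le_left 1 (w p' / w p)).trans (by simp)
  have hmul (p : X × Y) (ν : Measure (X × Y)) :
      w p * ∫⁻ p', accept w p p' ∂ν = ∫⁻ p', min (w p) (w p') ∂ν := by
    rw [← lintegral_const_mul _ (haccp p)]
    exact lintegral_congr fun p' => mul_accept (hwt p) p'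
  have hsymm : ∫⁻ p, w p * ∫⁻ p' in A, accept w p p' ∂P ∂P =
      ∫⁻ p in A, w p * ∫⁻ p', accept w p p' ∂P ∂P := by
    simp_rw [hmul]
    rw [lintegral_lintegral_swap hmin.aemeasurable]
    simp_rw [min_comm]
  have hpt (p : X × Y) :
      w p * (P.withDensity (accept w p) +
        (1 - ∫⁻ p', accept w p p' ∂P) • Measure.dirac p) A =
      w p * (∫⁻ p' in A, accept w p p' ∂P) +
        A.indicator (fun p => w p * (1 - ∫⁻ p', accept w p p' ∂P)) p := by
    rw [Measure.add_apply, Measure.smul_apply, withDensity_apply _ hA,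
      Measure.dirac_apply' _ hA, smul_eq_mul, mul_add]
    by_cases hp : p ∈ A <;> simp [hp]
  have hsecond : Measurable fun p => w p * (1 - ∫⁻ p', accept w p p' ∂P) :=
    hw.mul (measurable_const.sub hint)
  rw [lintegral_withDensity_eq_lintegral_mul_non_measurable _ hw
    (Filter.Eventually.of_forall fun p => (hwt p).lt_top)]
  simp only [Pi.mul_apply, hpt]
  rw [lintegral_add_right _ (hsecond.indicator hA), hsymm, lintegral_indicator hA,
    ← lintegral_add_right _ hsecond, withDensity_apply _ hA]
  refine lintegral_congr fun p => ?_
  rw [← mul_add, add_tsub_cancel_of_le (hle p), mul_one]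

theorem statement1
    (dxm : Measure X) [SigmaFinite dxm] (dxY : Measure Y) [SigmaFinite dxY]
    (γm : X → ℝ≥0∞) (γn q : X × Y → ℝ≥0∞)
    (hγm : Measurable γm) (hγmfin : ∀ x, γm x ≠ ⊤)
    (hγn : Measurable γn) (hγnfin : ∀ p, γn p ≠ ⊤)
    (Zm Zn : ℝ≥0∞)
    (hZm : Zm = ∫⁻ x, γm x ∂dxm) (hZm0 : 0 < Zm) (hZmt : Zm ≠ ⊤)
    (hZn : Zn = ∫⁻ p, γn p ∂(dxm.prod dxY)) (hZn0 : 0 < Zn) (hZnt : Zn ≠ ⊤)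
    (hq : Measurable q) (hqpos : ∀ p, 0 < q p) (hqfin : ∀ p, q p ≠ ⊤)
    (hqdens : ∀ x, ∫⁻ y, q (x, y) ∂dxY = 1)
    (B : ℝ≥0∞) (hBt : B ≠ ⊤)
    (hA1 : ∀ p : X × Y, 0 < γn p / Zn → weight γm γn q p ≤ B)
    (μ : Measure X) [IsProbabilityMeasure μ]
    (hμ0 : 0 < ∫⁻ x, ratioN dxY γm γn Zm Zn x ∂μ)
    (hμt : (∫⁻ x, ratioN dxY γm γn Zm Zn x ∂μ) ≠ ⊤) :
    IsProbabilityMeasure (omegaN dxY γm γn Zm Zn μ) ∧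
      ∀ A : Set (X × Y), MeasurableSet A →
        ∫⁻ p, mhK dxY γm γn q μ p A ∂(omegaN dxY γm γn Zm Zn μ) =
          omegaN dxY γm γn Zm Zn μ A := by
  have hw : Measurable (weight γm γn q) := hγn.div ((hγm.comp measurable_fst).mul hq)
  have hsec {f : X × Y → ℝ≥0∞} (hf : Measurable f) (x : X) : Measurable fun y => f (x, y) :=
    hf.comp measurable_prodMk_left
  have hwB (p : X × Y) : weight γm γn q p ≤ B := by
    by_cases h : γn p = 0
    · simp [weight, h]
    · exact hA1 p (ENNReal.div_pos h hZnt)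
  have hγn0 (p : X × Y) (h : γm p.1 = 0) : γn p = 0 := by
    by_contra hne
    refine hBt (top_le_iff.1 ((hwB p).trans' ?_))
    simp [weight, h, ENNReal.div_zero hne]
  have hwq (p : X × Y) : weight γm γn q p * q p = γn p / γm p.1 := by
    by_cases h : γm p.1 = 0
    · simp [weight, h, hγn0 p h]
    · rw [weight, div_eq_mul_inv, div_eq_mul_inv,
        ENNReal.mul_inv (Or.inl h) (Or.inl (hγmfin _)), mul_assoc, mul_assoc,
        ENNReal.inv_mul_cancel (hqpos p).ne' (hqfin p), mul_one]
  have hγnle (p : X × Y) : γn p ≤ B * γm p.1 * q p := by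
    by_cases h : γm p.1 = 0
    · simp [hγn0 p h]
    · have h' := hwB p
      rw [weight, ENNReal.div_le_iff (mul_ne_zero h (hqpos p).ne')
        (ENNReal.mul_ne_top (hγmfin _) (hqfin p))] at h'
      rwa [mul_assoc]
  have hmargmeas : Measurable (margN dxY γn Zn) :=
    hγn.lintegral_prod_right'.div_const _
  have hmargtop (x : X) : margN dxY γn Zn x ≠ ⊤ := by
    refine ENNReal.div_ne_top (ne_top_of_le_ne_top (ENNReal.mul_ne_top hBt (hγmfin x)) ?_) hZn0.ne'
    calc ∫⁻ y, γn (x, y) ∂dxY ≤ ∫⁻ y, B * γm x * q (x, y) ∂dxY :=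
          lintegral_mono fun y => hγnle (x, y)
      _ = B * γm x := by
          rw [lintegral_const_mul _ (hsec hq x), hqdens, mul_one]
  have hratio : Measurable (ratioN dxY γm γn Zm Zn) :=
    hmargmeas.div (hγm.div_const _)
  have hcond : Measurable (condN dxY γn Zn) :=
    (hγn.div_const _).div (hmargmeas.comp measurable_fst)
  have hdens : Measurable fun p : X × Y =>
      ratioN dxY γm γn Zm Zn p.1 * condN dxY γn Zn p :=
    (hratio.comp measurable_fst).mul hcond
  have hsection (x : X) : ∫⁻ y, γn (x, y) / Zn ∂dxY = margN dxY γn Zn x := by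
    simp only [margN, div_eq_mul_inv]
    exact lintegral_mul_const _ (hsec hγn x)
  have hinner (x : X) : ∫⁻ y, ratioN dxY γm γn Zm Zn x * condN dxY γn Zn (x, y) ∂dxY =
      ratioN dxY γm γn Zm Zn x := by
    rw [lintegral_const_mul _ (hsec hcond x)]
    by_cases h0 : margN dxY γn Zn x = 0
    · simp [ratioN, h0]
    · have : ∫⁻ y, condN dxY γn Zn (x, y) ∂dxY = 1 := by
        simp only [condN]
        simp_rw [div_eq_mul_inv _ (margN dxY γn Zn x)]
        rw [lintegral_mul_const _ (hsec (hγn.div_const Zn) x), hsection,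
          ENNReal.mul_inv_cancel h0 (hmargtop x)]
      rw [this, mul_one]
  have hP : IsProbabilityMeasure (proposal dxY q μ) := by
    constructor
    rw [proposal, withDensity_apply _ MeasurableSet.univ, Measure.restrict_univ,
      lintegral_prod _ hq.aemeasurable]
    simp [hqdens]
  have hae : (fun p : X × Y => ratioN dxY γm γn Zm Zn p.1 * condN dxY γn Zn p) =ᵐ[μ.prod dxY]
      (Zm / Zn) • (q * weight γm γn q) := by
    refine (Measure.ae_prod_iff_ae_ae (measurableSet_eq_fun hdens
      ((hq.mul hw).const_smul _))).2 (Filter.Eventually.of_forall fun x => ?_)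
    have hkey (y : Y) (h : margN dxY γn Zn x = 0 → γn (x, y) = 0) :
        ratioN dxY γm γn Zm Zn x * condN dxY γn Zn (x, y) =
          ((Zm / Zn) • (q * weight γm γn q)) (x, y) := by
      rw [Pi.smul_apply, Pi.mul_apply, mul_comm (q _), hwq, smul_eq_mul]
      by_cases hm : margN dxY γn Zn x = 0
      · simp [condN, h hm]
      · by_cases hg : γm x = 0
        · simp [condN, hγn0 (x, y) hg]
        · simp only [ratioN, condN, div_eq_mul_inv]
          rw [ENNReal.mul_inv (Or.inl hg) (Or.inl (hγmfin x)), inv_inv]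
          calc _ = margN dxY γn Zn x * (margN dxY γn Zn x)⁻¹ *
                (Zm * Zn⁻¹ * (γn (x, y) * (γm x)⁻¹)) := by ring
            _ = _ := by rw [ENNReal.mul_inv_cancel hm (hmargtop x), one_mul]
    by_cases hm : margN dxY γn Zn x = 0
    · have h0 := hm
      rw [← hsection, lintegral_eq_zero_iff
        (hsec (hγn.div_const Zn) x)] at h0
      filter_upwards [h0] with y hy
      refine hkey y fun _ => ?_
      simpa [ENNReal.div_eq_zero_iff, hZnt] using hy
    · exact Filter.Eventually.of_forall fun y => hkey y fun h => absurd h hm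
  have homega : omegaN dxY γm γn Zm Zn μ =
      ((∫⁻ x, ratioN dxY γm γn Zm Zn x ∂μ)⁻¹ * (Zm / Zn)) •
        (proposal dxY q μ).withDensity (weight γm γn q) := by
    rw [omegaN, withDensity_congr_ae hae, withDensity_smul _ (hq.mul hw), smul_smul, proposal,
      withDensity_mul _ hq hw]
  refine ⟨⟨?_⟩, fun A hA => ?_⟩
  · rw [omegaN, Measure.smul_apply, withDensity_apply _ MeasurableSet.univ, Measure.restrict_univ,
      lintegral_prod _ hdens.aemeasurable]
    simp only [hinner]
    exact ENNReal.inv_mul_cancel hμ0.ne' hμt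
  · rw [homega, lintegral_smul_measure, Measure.smul_apply]
    congr 1
    exact lintegral_accept_kernel _ hw (fun p => ne_top_of_le_ne_top hBt (hwB p)) hA

end

end Paper
end

section
/- For every measurable f: Y → ℝ with |f| ≤ 1, the series f̂(x) := Σ_{i=0}^∞ (K^i f(x) − ω(f)) converges absolutely for every x ∈ Y, defines a measurable function with |f̂(x)| ≤ 1/(1 − ρ) for all x, satisfies ω(f̂) = 0, and solves the Poisson equation: f(x) − ω(f) = f̂(x) − K f̂(x) for every x ∈ Y. -/
open MeasureTheory
open scoped ENNReal

namespace Paper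

noncomputable section

/-- Integration against `μ.bind κ` is iterated integration. -/
theorem integral_bind_of_integrable {α β : Type*} [MeasurableSpace α] [MeasurableSpace β]
    {μ : Measure α} {κ : α → Measure β} (hκ : Measurable κ) {f : β → ℝ}
    (hf : Integrable f (μ.bind κ)) :
    ∫ y, f y ∂(μ.bind κ) = ∫ x, ∫ y, f y ∂(κ x) ∂μ := by
  have h : (ProbabilityTheory.Kernel.comp ⟨κ, hκ⟩
      (ProbabilityTheory.Kernel.const Unit μ)) () = μ.bind κ := by
    rw [ProbabilityTheory.Kernel.comp_apply, ProbabilityTheory.Kernel.const_apply]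
    rfl
  have h' := ProbabilityTheory.Kernel.integral_comp (f := f) (a := ())
    (κ := ProbabilityTheory.Kernel.const Unit μ) (η := ⟨κ, hκ⟩) (by rwa [h])
  rwa [h, ProbabilityTheory.Kernel.const_apply] at h'

section iterK

variable {Y : Type*} [MeasurableSpace Y] {K : Y → Measure Y}

theorem measurable_iterK (hK : Measurable K) (m : ℕ) : Measurable (iterK K m) := by
  induction m with
  | zero => exact Measure.measurable_dirac
  | succ m ih => exact (Measure.measurable_bind' hK).comp ih

theorem isProbabilityMeasure_iterK (hK : Measurable K) (hKprob : ∀ x, IsProbabilityMeasure (K x))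
    (m : ℕ) (x : Y) : IsProbabilityMeasure (iterK K m x) := by
  induction m with
  | zero => exact Measure.dirac.isProbabilityMeasure
  | succ m ih => exact isProbabilityMeasure_bind hK.aemeasurable (.of_forall hKprob)

theorem iterK_succ_eq_bind_iterK (hK : Measurable K) (m : ℕ) (x : Y) :
    iterK K (m + 1) x = (K x).bind (iterK K m) := by
  induction m with
  | zero => exact (Measure.dirac_bind hK x).trans Measure.bind_dirac.symm
  | succ m ih =>
    change (iterK K (m + 1) x).bind K = _
    rw [ih, Measure.bind_bind (measurable_iterK hK m).aemeasurable hK.aemeasurable]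
    rfl

theorem bind_iterK_of_bind_eq (hK : Measurable K) {ω : Measure Y} (hω : ω.bind K = ω) (m : ℕ) :
    ω.bind (iterK K m) = ω := by
  induction m with
  | zero => exact Measure.bind_dirac
  | succ m ih =>
    change ω.bind (fun x => (iterK K m x).bind K) = ω
    rw [← Measure.bind_bind (measurable_iterK hK m).aemeasurable hK.aemeasurable, ih, hω]

theorem measurable_integral_iterK (hK : Measurable K) (hKprob : ∀ x, IsProbabilityMeasure (K x))
    {f : Y → ℝ} (hf : Measurable f) (m : ℕ) : Measurable fun x => ∫ y, f y ∂(iterK K m x) :=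
  haveI : ProbabilityTheory.IsMarkovKernel
      (⟨iterK K m, measurable_iterK hK m⟩ : ProbabilityTheory.Kernel Y Y) :=
    ⟨isProbabilityMeasure_iterK hK hKprob m⟩
  (hf.stronglyMeasurable.integral_kernel
    (κ := ⟨iterK K m, measurable_iterK hK m⟩)).measurable

end iterK

theorem statement6 {Y : Type*} [MeasurableSpace Y]
    (K : Y → Measure Y)
    (hKmeas : ∀ A : Set Y, MeasurableSet A → Measurable fun x => K x A)
    (hKprob : ∀ x, IsProbabilityMeasure (K x))
    (ω : Measure Y) [IsProbabilityMeasure ω]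
    (hinv : ∀ A : Set Y, MeasurableSet A → ∫⁻ x, K x A ∂ω = ω A)
    (ρ : ℝ) (hρ0 : 0 ≤ ρ) (hρ1 : ρ < 1)
    (hunif : ∀ f : Y → ℝ, Measurable f → (∀ y, |f y| ≤ 1) → ∀ x : Y, ∀ m : ℕ,
      |(∫ y, f y ∂(iterK K m x)) - ∫ y, f y ∂ω| ≤ ρ ^ m)
    (f : Y → ℝ) (hf : Measurable f) (hfb : ∀ y, |f y| ≤ 1) :
    (∀ x : Y, Summable fun i : ℕ => |(∫ y, f y ∂(iterK K i x)) - ∫ y, f y ∂ω|) ∧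
      Measurable (fun x : Y => ∑' i : ℕ, ((∫ y, f y ∂(iterK K i x)) - ∫ y, f y ∂ω)) ∧
      (∀ x : Y, |∑' i : ℕ, ((∫ y, f y ∂(iterK K i x)) - ∫ y, f y ∂ω)| ≤ 1 / (1 - ρ)) ∧
      (∫ x, (∑' i : ℕ, ((∫ y, f y ∂(iterK K i x)) - ∫ y, f y ∂ω)) ∂ω) = 0 ∧
      ∀ x : Y, f x - ∫ y, f y ∂ω =
        (∑' i : ℕ, ((∫ y, f y ∂(iterK K i x)) - ∫ y, f y ∂ω)) -
          ∫ z, (∑' i : ℕ, ((∫ y, f y ∂(iterK K i z)) - ∫ y, f y ∂ω)) ∂(K x) := by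
  have hK : Measurable K := Measure.measurable_of_measurable_coe K hKmeas
  have hω : ω.bind K = ω := by
    ext A hA
    rw [Measure.bind_apply hA hK.aemeasurable, hinv A hA]
  have hfint : ∀ μ : Measure Y, IsProbabilityMeasure μ → Integrable f μ := fun μ _ =>
    Integrable.of_bound hf.aestronglyMeasurable 1 (.of_forall hfb)
  set g : ℕ → Y → ℝ := fun i x => (∫ y, f y ∂(iterK K i x)) - ∫ y, f y ∂ω
  change (∀ x, Summable fun i => |g i x|) ∧ Measurable (fun x => ∑' i, g i x) ∧
    (∀ x, |∑' i, g i x| ≤ 1 / (1 - ρ)) ∧ (∫ x, ∑' i, g i x ∂ω) = 0 ∧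
    ∀ x, f x - ∫ y, f y ∂ω = (∑' i, g i x) - ∫ z, ∑' i, g i z ∂(K x)
  have hgb : ∀ i x, |g i x| ≤ ρ ^ i := fun i x => hunif f hf hfb x i
  have hgeo := summable_geometric_of_lt_one hρ0 hρ1
  have hsum : ∀ x, Summable fun i => |g i x| := fun x =>
    .of_nonneg_of_le (fun _ => abs_nonneg _) (hgb · x) hgeo
  have hImeas := measurable_integral_iterK hK hKprob hf
  have hgm : ∀ i, Measurable (g i) := fun i => (hImeas i).sub_const _
  have htsum : ∀ μ : Measure Y, IsProbabilityMeasure μ →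
      ∫ x, ∑' i, g i x ∂μ = ∑' i, ∫ x, g i x ∂μ := fun μ _ =>
    (hasSum_integral_of_dominated_convergence (fun i _ => ρ ^ i)
      (fun i => (hgm i).aestronglyMeasurable) (fun i => .of_forall (hgb i))
      (.of_forall fun _ => hgeo) (integrable_const _)
      (.of_forall fun x => (hsum x).of_abs.hasSum)).tsum_eq.symm
  have hgint : ∀ (i : ℕ) (μ : Measure Y), IsProbabilityMeasure μ →
      IsProbabilityMeasure (μ.bind (iterK K i)) →
      ∫ x, g i x ∂μ = (∫ y, f y ∂(μ.bind (iterK K i))) - ∫ y, f y ∂ω := by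
    intro i μ _ _
    have hI : Integrable (fun x => ∫ y, f y ∂(iterK K i x)) μ :=
      .of_bound (hImeas i).aestronglyMeasurable 1 (.of_forall fun x =>
        haveI := isProbabilityMeasure_iterK hK hKprob i x
        (norm_integral_le_of_norm_le_const (.of_forall hfb)).trans (by simp))
    rw [integral_sub hI (integrable_const _),
      integral_bind_of_integrable (measurable_iterK hK i) (hfint _ inferInstance)]
    simp
  refine ⟨hsum, Measurable.tsum hgm, fun x => ?_, ?_, fun x => ?_⟩
  · rw [one_div, ← tsum_geometric_of_lt_one hρ0 hρ1]
    exact tsum_of_norm_bounded (f := fun i => g i x) hgeo.hasSum (hgb · x)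
  · rw [htsum ω inferInstance]
    have hzero : ∀ i, ∫ x, g i x ∂ω = 0 := fun i => by
      have h := bind_iterK_of_bind_eq hK hω i
      rw [hgint i ω inferInstance (by rw [h]; infer_instance), h, sub_self]
    simp [hzero]
  · have hstep : ∀ i, ∫ z, g i z ∂(K x) = g (i + 1) x := fun i => by
      have h := iterK_succ_eq_bind_iterK hK i x
      rw [hgint i (K x) (hKprob x) (h ▸ isProbabilityMeasure_iterK hK hKprob (i + 1) x), ← h]
    rw [htsum (K x) (hKprob x), (hsum x).of_abs.tsum_eq_zero_add]
    simp only [hstep, add_sub_cancel_right]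
    change _ = (∫ y, f y ∂(Measure.dirac x)) - _
    rw [integral_dirac' f x hf.stronglyMeasurable]

end

end Paper
end

section
/- Set D_n := B_n Z_{n-1}/Z_n. For every probability measure μ on E_{n-1} with μ(π_{n/n-1}) > 0 and every measurable f: E_n → ℝ with |f| ≤ 1, |ω_n(μ)(f) − π_n(f)| ≤ 2 D_n ‖μ − π_{n-1}‖_tv. -/
open MeasureTheory
open scoped ENNReal NNReal

namespace Paper

noncomputable section

variable {X Y : Type*} [MeasurableSpace X] [MeasurableSpace Y]

lemma abs_integral_sub_le_tvDist {Z : Type*} [MeasurableSpace Z] (μ ν : Measure Z)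
    [IsFiniteMeasure μ] [IsFiniteMeasure ν] {f : Z → ℝ} (hf : Measurable f)
    (hf1 : ∀ z, |f z| ≤ 1) : |(∫ z, f z ∂μ) - ∫ z, f z ∂ν| ≤ tvDist μ ν := by
  have hbdd : BddAbove (Set.range fun g : { g : Z → ℝ // Measurable g ∧ ∀ z, |g z| ≤ 1 } =>
      |(∫ z, g.1 z ∂μ) - ∫ z, g.1 z ∂ν|) := by
    refine ⟨μ.real Set.univ + ν.real Set.univ, ?_⟩
    rintro _ ⟨⟨g, -, hg⟩, rfl⟩
    refine (abs_sub _ _).trans (add_le_add ?_ ?_)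
    · simpa using norm_integral_le_of_norm_le_const (μ := μ) (f := g) (Filter.Eventually.of_forall hg)
    · simpa using norm_integral_le_of_norm_le_const (μ := ν) (f := g) (Filter.Eventually.of_forall hg)
  exact le_ciSup hbdd ⟨f, hf, hf1⟩

lemma abs_integral_sub_le_mul_tvDist {Z : Type*} [MeasurableSpace Z] (μ ν : Measure Z)
    [IsFiniteMeasure μ] [IsFiniteMeasure ν] {f : Z → ℝ} (hf : Measurable f) {D : ℝ}
    (hD : 0 ≤ D) (hfD : ∀ z, |f z| ≤ D) :
    |(∫ z, f z ∂μ) - ∫ z, f z ∂ν| ≤ D * tvDist μ ν := by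
  rcases hD.eq_or_lt with rfl | hD
  · have hf0 : f = fun _ => 0 := funext fun z => abs_nonpos_iff.1 (hfD z)
    simp [hf0]
  · have h := abs_integral_sub_le_tvDist μ ν (f := fun z => D⁻¹ * f z) (hf.const_mul _)
      fun z => by
        rw [abs_mul, abs_of_pos (inv_pos.2 hD), inv_mul_le_iff₀ hD, mul_one]
        exact hfD z
    simp only [integral_const_mul, ← mul_sub, abs_mul, abs_of_pos (inv_pos.2 hD)] at h
    rwa [inv_mul_le_iff₀ hD] at h

lemma lintegral_prod_withDensity_univ (dxY : Measure Y) [SigmaFinite dxY] (μ : Measure X)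
    [SFinite μ] {h : X × Y → ℝ≥0∞} (hh : Measurable h) :
    ((μ.prod dxY).withDensity h) Set.univ = ∫⁻ x, ∫⁻ y, h (x, y) ∂dxY ∂μ := by
  rw [withDensity_apply _ MeasurableSet.univ, Measure.restrict_univ,
    lintegral_prod _ hh.aemeasurable]

/-- Pushing finite measures through a kernel of mass at most `D` multiplies the total variation
distance by at most `D`. -/
lemma abs_integral_prod_withDensity_sub_le (dxY : Measure Y) [SigmaFinite dxY] (μ ν : Measure X)
    [IsFiniteMeasure μ] [IsFiniteMeasure ν] {h : X × Y → ℝ≥0∞} (hh : Measurable h) {D : ℝ≥0∞}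
    (hDt : D ≠ ⊤) (hD : ∀ x, ∫⁻ y, h (x, y) ∂dxY ≤ D) {f : X × Y → ℝ} (hf : Measurable f)
    (hf1 : ∀ z, |f z| ≤ 1) :
    |(∫ z, f z ∂((μ.prod dxY).withDensity h)) - ∫ z, f z ∂((ν.prod dxY).withDensity h)| ≤
      D.toReal * tvDist μ ν := by
  have hint (ρ : Measure X) [IsFiniteMeasure ρ] :
      ∫ z, f z ∂((ρ.prod dxY).withDensity h) =
        ∫ x, ∫ y, (h (x, y)).toReal * f (x, y) ∂dxY ∂ρ := by
    have hfin : ∫⁻ z, h z ∂(ρ.prod dxY) ≠ ⊤ := by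
      rw [lintegral_prod _ hh.aemeasurable]
      exact ((lintegral_mono hD).trans_lt (by
        simpa using ENNReal.mul_lt_top hDt.lt_top (measure_lt_top ρ _))).ne
    have hlt : ∀ᵐ z ∂(ρ.prod dxY), h z < ⊤ := ae_lt_top hh hfin
    have : IsFiniteMeasure ((ρ.prod dxY).withDensity h) := isFiniteMeasure_withDensity hfin
    have hfi : Integrable f ((ρ.prod dxY).withDensity h) :=
      Integrable.of_bound hf.aestronglyMeasurable 1 (Filter.Eventually.of_forall hf1)
    rw [integral_withDensity_eq_integral_toReal_smul hh hlt]
    simp only [smul_eq_mul]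
    rw [integral_prod]
    exact (integrable_withDensity_iff_integrable_smul' hh hlt).1 hfi
  rw [hint μ, hint ν]
  refine abs_integral_sub_le_mul_tvDist μ ν ?_ ENNReal.toReal_nonneg fun x => ?_
  · exact (hh.ennreal_toReal.mul hf).stronglyMeasurable.integral_prod_right'.measurable
  · rw [← Real.norm_eq_abs, ← toReal_enorm]
    refine ENNReal.toReal_mono hDt ((enorm_integral_le_lintegral_enorm _).trans
      ((lintegral_mono fun y => ?_).trans (hD x)))
    rw [enorm_mul]
    calc ‖(h (x, y)).toReal‖ₑ * ‖f (x, y)‖ₑ ≤ h (x, y) * 1 := by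
          gcongr
          · rw [Real.enorm_of_nonneg ENNReal.toReal_nonneg]
            exact ENNReal.ofReal_toReal_le
          · rw [← ofReal_norm, ENNReal.ofReal_le_one]
            exact hf1 _
      _ = h (x, y) := mul_one _

theorem statement13
    (dxm : Measure X) [SigmaFinite dxm] (dxY : Measure Y) [SigmaFinite dxY]
    (γm : X → ℝ≥0∞) (γn q : X × Y → ℝ≥0∞)
    (hγm : Measurable γm) (hγmfin : ∀ x, γm x ≠ ⊤)
    (hγn : Measurable γn) (hγnfin : ∀ p, γn p ≠ ⊤)
    (Zm Zn : ℝ≥0∞)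
    (hZm : Zm = ∫⁻ x, γm x ∂dxm) (hZm0 : 0 < Zm) (hZmt : Zm ≠ ⊤)
    (hZn : Zn = ∫⁻ p, γn p ∂(dxm.prod dxY)) (hZn0 : 0 < Zn) (hZnt : Zn ≠ ⊤)
    (hq : Measurable q) (hqpos : ∀ p, 0 < q p) (hqfin : ∀ p, q p ≠ ⊤)
    (hqdens : ∀ x, ∫⁻ y, q (x, y) ∂dxY = 1)
    (B : ℝ≥0∞) (hBt : B ≠ ⊤)
    (hA1 : ∀ p : X × Y, 0 < γn p / Zn → weight γm γn q p ≤ B)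
    :
    ∀ μ : Measure X, IsProbabilityMeasure μ →
      0 < ∫⁻ x, ratioN dxY γm γn Zm Zn x ∂μ →
      ∀ f : X × Y → ℝ, Measurable f → (∀ z, |f z| ≤ 1) →
        |(∫ z, f z ∂(omegaN dxY γm γn Zm Zn μ)) -
            ∫ z, f z ∂((dxm.prod dxY).withDensity fun p => γn p / Zn)| ≤
          2 * (B * Zm / Zn).toReal * tvDist μ (dxm.withDensity fun x => γm x / Zm) := by
  intro μ hμ hpos f hf hf1
  set D : ℝ≥0∞ := B * Zm / Zn with hDdef
  have hDt : D ≠ ⊤ := ENNReal.div_ne_top (ENNReal.mul_ne_top hBt hZmt) hZn0.ne'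
  set π : Measure X := dxm.withDensity fun x => γm x / Zm with hπ
  set r : X → ℝ≥0∞ := ratioN dxY γm γn Zm Zn with hr
  set h : X × Y → ℝ≥0∞ := fun p => r p.1 * condN dxY γn Zn p with hhdef
  have hmarg : Measurable (margN dxY γn Zn) := hγn.lintegral_prod_right'.div_const _
  have hγmZ : Measurable fun x => γm x / Zm := hγm.div_const _
  have hrm : Measurable r := hmarg.div hγmZ
  have hcond : Measurable (condN dxY γn Zn) :=
    (hγn.div_const _).div (hmarg.comp measurable_fst)
  have hhm : Measurable h := (hrm.comp measurable_fst).mul hcond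
  have hγle (p : X × Y) : γn p ≤ B * γm p.1 * q p := by
    rcases eq_or_ne (γn p) 0 with h0 | h0
    · simp [h0]
    · have hw := hA1 p (ENNReal.div_pos h0 hZnt)
      rw [weight, ENNReal.div_le_iff_le_mul (Or.inr hBt)
        (Or.inl (ENNReal.mul_ne_top (hγmfin _) (hqfin _)))] at hw
      rwa [mul_assoc]
  have hmle (x : X) : margN dxY γn Zn x ≤ B * γm x / Zn := by
    refine ENNReal.div_le_div_right ?_ _
    calc ∫⁻ y, γn (x, y) ∂dxY ≤ ∫⁻ y, B * γm x * q (x, y) ∂dxY :=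
          lintegral_mono fun y => hγle (x, y)
      _ = B * γm x := by
          rw [lintegral_const_mul _ (by fun_prop), hqdens, mul_one]
  have hmt (x : X) : margN dxY γn Zn x ≠ ⊤ :=
    ((hmle x).trans_lt (ENNReal.div_lt_top (ENNReal.mul_ne_top hBt (hγmfin x)) hZn0.ne')).ne
  have hγm0 (x : X) (hx : margN dxY γn Zn x ≠ 0) : γm x / Zm ≠ 0 := fun h0 => by
    have h1 : γm x = 0 := (ENNReal.div_eq_zero_iff.1 h0).resolve_right hZmt
    exact hx (by simpa [h1] using hmle x)
  have hγmt (x : X) : γm x / Zm ≠ ⊤ := ENNReal.div_ne_top (hγmfin x) hZm0.ne'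
  have hr0 (x : X) (hx : margN dxY γn Zn x = 0) : r x = 0 := by simp [hr, ratioN, hx]
  have hrD (x : X) : r x ≤ D := by
    refine ENNReal.div_le_of_le_mul ((hmle x).trans_eq ?_)
    rw [hDdef]
    simp only [div_eq_mul_inv]
    calc B * γm x * Zn⁻¹ = B * γm x * Zn⁻¹ * (Zm * Zm⁻¹) := by
          rw [ENNReal.mul_inv_cancel hZm0.ne' hZmt, mul_one]
      _ = _ := by ring
  have hhr (x : X) : ∫⁻ y, h (x, y) ∂dxY = r x := by
    rcases eq_or_ne (margN dxY γn Zn x) 0 with h0 | h0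
    · simp [hhdef, hr0 x h0]
    · have hc : ∫⁻ y, condN dxY γn Zn (x, y) ∂dxY = 1 := by
        simp only [condN, div_eq_mul_inv]
        rw [lintegral_mul_const _ (by fun_prop), lintegral_mul_const _ (by fun_prop),
          ← div_eq_mul_inv]
        exact ENNReal.mul_inv_cancel h0 (hmt x)
      simp only [hhdef]
      rw [lintegral_const_mul _ (by fun_prop), hc, mul_one]
  have : IsProbabilityMeasure π := ⟨by
    rw [hπ, withDensity_apply _ MeasurableSet.univ, Measure.restrict_univ]
    simp only [div_eq_mul_inv]
    rw [lintegral_mul_const _ hγm, ← hZm, ENNReal.mul_inv_cancel hZm0.ne' hZmt]⟩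
  have hπn : (dxm.prod dxY).withDensity (fun p => γn p / Zn) = (π.prod dxY).withDensity h := by
    rw [hπ, prod_withDensity_left hγmZ,
      ← withDensity_mul _ (f := fun p : X × Y => γm p.1 / Zm) (hγmZ.comp measurable_fst) hhm]
    refine withDensity_congr_ae ?_
    have hms : MeasurableSet {p : X × Y | margN dxY γn Zn p.1 = 0 → γn p = 0} :=
      MeasurableSet.imp ((hmarg.comp measurable_fst) (measurableSet_singleton 0))
        (hγn (measurableSet_singleton 0))
    have hae : ∀ᵐ p ∂(dxm.prod dxY), margN dxY γn Zn p.1 = 0 → γn p = 0 := by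
      refine (Measure.ae_prod_iff_ae_ae hms).2 (Filter.Eventually.of_forall fun x => ?_)
      by_cases h0 : margN dxY γn Zn x = 0
      · have h1 := (ENNReal.div_eq_zero_iff.1 h0).resolve_right hZnt
        filter_upwards [(lintegral_eq_zero_iff (by fun_prop)).1 h1] with y hy _ using hy
      · exact Filter.Eventually.of_forall fun y h1 => absurd h1 h0
    filter_upwards [hae] with p hp
    simp only [Pi.mul_apply, hhdef]
    by_cases h0 : margN dxY γn Zn p.1 = 0
    · simp [hr0 _ h0, hp h0]
    · rw [hr, ratioN, condN, ← mul_assoc, ENNReal.mul_div_cancel (hγm0 _ h0) (hγmt _),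
        ENNReal.mul_div_cancel h0 (hmt _)]
  have hmass (ρ : Measure X) [IsProbabilityMeasure ρ] :
      ((ρ.prod dxY).withDensity h) Set.univ = ∫⁻ x, r x ∂ρ := by
    rw [lintegral_prod_withDensity_univ dxY ρ hhm]
    simp only [hhr]
  have hafin : ∫⁻ x, r x ∂μ ≠ ⊤ :=
    ((lintegral_mono hrD).trans_lt (by simpa using hDt.lt_top)).ne
  have hπ1 : ((π.prod dxY).withDensity h) Set.univ = 1 := by
    rw [← hπn, withDensity_apply _ MeasurableSet.univ, Measure.restrict_univ]
    simp only [div_eq_mul_inv]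
    rw [lintegral_mul_const _ hγn, ← hZn, ENNReal.mul_inv_cancel hZn0.ne' hZnt]
  have key {g : X × Y → ℝ} (hg : Measurable g) (hg1 : ∀ z, |g z| ≤ 1) :=
    abs_integral_prod_withDensity_sub_le dxY μ π hhm hDt (fun x => (hhr x).trans_le (hrD x)) hg hg1
  have hkf := key hf hf1
  have hk1 := key (g := fun _ => 1) measurable_const (by simp)
  have : IsFiniteMeasure ((μ.prod dxY).withDensity h) :=
    ⟨by rw [hmass]; exact hafin.lt_top⟩
  have hA : |∫ z, f z ∂((μ.prod dxY).withDensity h)| ≤ (∫⁻ x, r x ∂μ).toReal := by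
    have := norm_integral_le_of_norm_le_const (μ := (μ.prod dxY).withDensity h) (f := f)
      (Filter.Eventually.of_forall hf1)
    rwa [one_mul, measureReal_def, hmass] at this
  have ha : 0 < (∫⁻ x, r x ∂μ).toReal := ENNReal.toReal_pos hpos.ne' hafin
  simp only [integral_const, smul_eq_mul, mul_one, measureReal_def, hmass μ, hπ1,
    ENNReal.toReal_one] at hk1
  have hω : omegaN dxY γm γn Zm Zn μ =
      (∫⁻ x, r x ∂μ)⁻¹ • (μ.prod dxY).withDensity h := rfl
  rw [hω, hπn, integral_smul_measure, ENNReal.toReal_inv, smul_eq_mul]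
  generalize (∫⁻ x, r x ∂μ).toReal = a at *
  generalize ∫ z, f z ∂((μ.prod dxY).withDensity h) = A at *
  generalize ∫ z, f z ∂((π.prod dxY).withDensity h) = P at *
  have h1 : |a⁻¹ * A| ≤ 1 := by
    rwa [abs_mul, abs_of_pos (inv_pos.2 ha), inv_mul_le_iff₀ ha, mul_one]
  calc |a⁻¹ * A - P| = |(A - P) - a⁻¹ * A * (a - 1)| := by
        congr 1
        field_simp
        ring
    _ ≤ |A - P| + |a⁻¹ * A| * |a - 1| := by
        rw [← abs_mul]
        exact abs_sub _ _
    _ ≤ |A - P| + 1 * |a - 1| := by gcongr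
    _ ≤ 2 * D.toReal * tvDist μ π := by linarith

end

end Paper
end
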